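/- Every CSP_p context distributes over probabilistic choice up to ready trace equivalence: for any context C[·], C[⊕_{i∈I} πᵢ xᵢ] ≈_O ⊕_{i∈I} πᵢ C[xᵢ]. -/

import Mathlib

inductive Proc (A : Type) where
  | nd : List (A × Proc A) → Proc A
  | pr : List (ℝ × Proc A) → Proc A

namespace Proc

variable {A : Type} [DecidableEq A]

/-- The menu of a nondeterministic state: the set of initially enabled actions. -/
def menu : Proc A → Finset A
  | nd l => (l.map Prod.fst).toFinset
  | pr _ => ∅

/-- Deterministic action transition. -/
def step : Proc A → A → Option (Proc A)
  | nd l, a => (l.find? (fun x => x.1 = a)).map Prod.snd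
  | pr _, _ => none

/-- P¹ₛ(M) : the probability that the initial menu observed is M. -/
noncomputable def P1 : Proc A → Finset A → ℝ
  | nd l, M => if (l.map Prod.fst).toFinset = M then 1 else 0
  | pr l, M => (l.attach.map (fun x => x.1.1 * P1 x.1.2 M)).sum
termination_by p _ => sizeOf p
decreasing_by
  obtain ⟨⟨r, p⟩, hmem⟩ := x
  have h := List.sizeOf_lt_of_mem hmem
  simp at h ⊢
  omega

end Proc
/-- Flattening used when a probabilistic transition would lead to a probabilistic state. -/
def flat {A : Type} (w : ℝ) : Proc A → List (ℝ × Proc A)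
  | Proc.pr l => l.map (fun x => (w * x.1, x.2))
  | q => [(w, q)]

namespace Proc

variable {A : Type} [DecidableEq A]

/-- The derived process s_{(M,a)} : the process that `s` becomes, given that the
menu `M` was offered and the action `a ∈ M` was performed. -/
noncomputable def after : Proc A → Finset A → A → Option (Proc A)
  | nd l, M, a => if (l.map Prod.fst).toFinset = M then step (nd l) a else none
  | pr l, M, a =>
      let sel := l.filter (fun x => x.2.menu = M)
      let tot := (sel.map Prod.fst).sum
      let entries := sel.flatMap (fun x =>
        match x.2.step a with
        | none => []
        | some q => flat (x.1 / tot) q)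
      if entries.isEmpty then none else some (pr entries)

/-- The conditional ready-trace probability
`P_sⁿ(M | M₁,a₁,…,a_{n-1})`, where `none` represents undefinedness. -/
noncomputable def Pn : Proc A → List (Finset A × A) → Finset A → Option ℝ
  | s, [], M => some (P1 s M)
  | s, Ma :: rest, M =>
      if 0 < P1 s Ma.1 then (after s Ma.1 Ma.2).bind (fun s' => Pn s' rest M)
      else none

/-- Probabilistic ready trace equivalence `≈_O`. -/
noncomputable def RTEquiv (s t : Proc A) : Prop :=
  ∀ (tr : List (Finset A × A)) (M : Finset A), Pn s tr M = Pn t tr M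

/-- Well-formed process graphs: action-deterministic menus, probabilities in (0,1]
summing to one, and probabilistic transitions leading to nondeterministic states. -/
inductive WF : Proc A → Prop
  | nd (l : List (A × Proc A)) :
      (l.map Prod.fst).Nodup → (∀ x ∈ l, WF x.2) → WF (.nd l)
  | pr (l : List (ℝ × Proc A)) :
      (∀ x ∈ l, 0 < x.1 ∧ x.1 ≤ 1 ∧ ∃ l', x.2 = Proc.nd l') →
      (l.map Prod.fst).sum = 1 →
      (∀ x ∈ l, WF x.2) → WF (.pr l)

end Proc
/-- Syntax of the algebra CSP_p: empty process, action-guarded external choice,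
probabilistic choice, priority, lock-step parallel and parallel with
synchronization set L. -/
inductive CSPp (A : Type) where
  | delta : CSPp A
  | ext : List (A × CSPp A) → CSPp A
  | prob : List (ℝ × CSPp A) → CSPp A
  | theta : CSPp A → CSPp A
  | par : CSPp A → CSPp A → CSPp A
  | parL : Finset A → CSPp A → CSPp A → CSPp A

namespace Proc

variable {A : Type} [DecidableEq A]

/-- Flattening of a probabilistic branch, so that probabilistic transitions
lead to nondeterministic states. -/
def pflat (x : ℝ × Proc A) : List (ℝ × Proc A) :=
  match x.2 with
  | .pr l' => l'.map (fun z => (x.1 * z.1, z.2))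
  | q => [(x.1, q)]

variable [LT A] [DecidableRel ((· < ·) : A → A → Prop)]

/-- The list of branches of a menu that have maximal priority. -/
def maxBranches (l : List (A × Proc A)) : List (A × Proc A) :=
  l.filter (fun x => decide (¬ ∃ y ∈ l, x.1 < y.1))

/-- The priority operator Θ on process graphs: keep only the maximal-priority
actions of each menu. -/
inductive ThetaRel : Proc A → Proc A → Prop
  | nd (l m : List (A × Proc A)) :
      m.length = (maxBranches l).length →
      (∀ i (hi : i < (maxBranches l).length) (hi' : i < m.length),
        (m.get ⟨i, hi'⟩).1 = ((maxBranches l).get ⟨i, hi⟩).1) →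
      (∀ i (hi : i < (maxBranches l).length) (hi' : i < m.length),
        ThetaRel ((maxBranches l).get ⟨i, hi⟩).2 (m.get ⟨i, hi'⟩).2) →
      ThetaRel (.nd l) (.nd m)
  | pr (l m : List (ℝ × Proc A)) :
      m.length = l.length →
      (∀ i (hi : i < l.length) (hi' : i < m.length),
        (m.get ⟨i, hi'⟩).1 = (l.get ⟨i, hi⟩).1) →
      (∀ i (hi : i < l.length) (hi' : i < m.length),
        ThetaRel (l.get ⟨i, hi⟩).2 (m.get ⟨i, hi'⟩).2) →
      ThetaRel (.pr l) (.pr m)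

/-- The branches of `l` whose action is in `L` and can be matched by the menu `l'`. -/
def syncBranches (L : Finset A) (l l' : List (A × Proc A)) : List (A × Proc A) :=
  l.filter (fun x => decide (x.1 ∈ L) && (Proc.step (.nd l') x.1).isSome)

/-- The branches of `l` whose action is interleaved (not in `L`). -/
def freeBranches (L : Finset A) (l : List (A × Proc A)) : List (A × Proc A) :=
  l.filter (fun x => decide (x.1 ∉ L))

/-- `ParRel L p q r` : `r` is the parallel composition of `p` and `q` that
synchronizes on the actions in `L` and interleaves all other actions. -/
inductive ParRel (L : Finset A) : Proc A → Proc A → Proc A → Prop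
  | ndnd (l l' : List (A × Proc A)) (m₁ m₂ m₃ : List (A × Proc A)) :
      m₁.length = (syncBranches L l l').length →
      (∀ i (hi : i < (syncBranches L l l').length) (hi' : i < m₁.length),
        (m₁.get ⟨i, hi'⟩).1 = ((syncBranches L l l').get ⟨i, hi⟩).1) →
      (∀ i (hi : i < (syncBranches L l l').length) (hi' : i < m₁.length) q',
        Proc.step (.nd l') ((syncBranches L l l').get ⟨i, hi⟩).1 = some q' →
        ParRel L ((syncBranches L l l').get ⟨i, hi⟩).2 q' (m₁.get ⟨i, hi'⟩).2) →
      m₂.length = (freeBranches L l).length →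
      (∀ i (hi : i < (freeBranches L l).length) (hi' : i < m₂.length),
        (m₂.get ⟨i, hi'⟩).1 = ((freeBranches L l).get ⟨i, hi⟩).1) →
      (∀ i (hi : i < (freeBranches L l).length) (hi' : i < m₂.length),
        ParRel L ((freeBranches L l).get ⟨i, hi⟩).2 (.nd l') (m₂.get ⟨i, hi'⟩).2) →
      m₃.length = (freeBranches L l').length →
      (∀ i (hi : i < (freeBranches L l').length) (hi' : i < m₃.length),
        (m₃.get ⟨i, hi'⟩).1 = ((freeBranches L l').get ⟨i, hi⟩).1) →
      (∀ i (hi : i < (freeBranches L l').length) (hi' : i < m₃.length),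
        ParRel L (.nd l) ((freeBranches L l').get ⟨i, hi⟩).2 (m₃.get ⟨i, hi'⟩).2) →
      ParRel L (.nd l) (.nd l') (.nd (m₁ ++ m₂ ++ m₃))
  | prnd (l : List (ℝ × Proc A)) (q : Proc A) (m : List (ℝ × Proc A)) :
      (∀ l', q ≠ .pr l') →
      m.length = l.length →
      (∀ i (hi : i < l.length) (hi' : i < m.length),
        (m.get ⟨i, hi'⟩).1 = (l.get ⟨i, hi⟩).1) →
      (∀ i (hi : i < l.length) (hi' : i < m.length),
        ParRel L (l.get ⟨i, hi⟩).2 q (m.get ⟨i, hi'⟩).2) →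
      ParRel L (.pr l) q (.pr m)
  | ndpr (q : Proc A) (l' : List (ℝ × Proc A)) (m : List (ℝ × Proc A)) :
      (∀ l'', q ≠ .pr l'') →
      m.length = l'.length →
      (∀ i (hi : i < l'.length) (hi' : i < m.length),
        (m.get ⟨i, hi'⟩).1 = (l'.get ⟨i, hi⟩).1) →
      (∀ i (hi : i < l'.length) (hi' : i < m.length),
        ParRel L q (l'.get ⟨i, hi⟩).2 (m.get ⟨i, hi'⟩).2) →
      ParRel L q (.pr l') (.pr m)
  | prpr (l l' : List (ℝ × Proc A)) (m : List (ℝ × Proc A)) :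
      m.length = (l.flatMap (fun x => l'.map (fun x' => (x, x')))).length →
      (∀ i (hi : i < (l.flatMap (fun x => l'.map (fun x' => (x, x')))).length)
          (hi' : i < m.length),
        (m.get ⟨i, hi'⟩).1 =
          ((l.flatMap (fun x => l'.map (fun x' => (x, x')))).get ⟨i, hi⟩).1.1 *
          ((l.flatMap (fun x => l'.map (fun x' => (x, x')))).get ⟨i, hi⟩).2.1) →
      (∀ i (hi : i < (l.flatMap (fun x => l'.map (fun x' => (x, x')))).length)
          (hi' : i < m.length),
        ParRel L ((l.flatMap (fun x => l'.map (fun x' => (x, x')))).get ⟨i, hi⟩).1.2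
          ((l.flatMap (fun x => l'.map (fun x' => (x, x')))).get ⟨i, hi⟩).2.2
          (m.get ⟨i, hi'⟩).2) →
      ParRel L (.pr l) (.pr l') (.pr m)

variable [Fintype A]

/-- `Den p q` : the process graph `q` is the operational-semantics denotation of
the CSP_p term `p` (per the SOS rules of the paper). -/
inductive Den : CSPp A → Proc A → Prop
  | delta : Den .delta (.nd [])
  | ext (l : List (A × CSPp A)) (m : List (A × Proc A)) :
      m.length = l.length →
      (∀ i (hi : i < l.length) (hi' : i < m.length),
        (m.get ⟨i, hi'⟩).1 = (l.get ⟨i, hi⟩).1) →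
      (∀ i (hi : i < l.length) (hi' : i < m.length),
        Den (l.get ⟨i, hi⟩).2 (m.get ⟨i, hi'⟩).2) →
      Den (.ext l) (.nd m)
  | prob (l : List (ℝ × CSPp A)) (m : List (ℝ × Proc A)) :
      m.length = l.length →
      (∀ i (hi : i < l.length) (hi' : i < m.length),
        (m.get ⟨i, hi'⟩).1 = (l.get ⟨i, hi⟩).1) →
      (∀ i (hi : i < l.length) (hi' : i < m.length),
        Den (l.get ⟨i, hi⟩).2 (m.get ⟨i, hi'⟩).2) →
      Den (.prob l) (.pr (m.flatMap pflat))
  | theta (p : CSPp A) (q q' : Proc A) :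
      Den p q → ThetaRel q q' → Den (.theta p) q'
  | par (p₁ p₂ : CSPp A) (q₁ q₂ r : Proc A) :
      Den p₁ q₁ → Den p₂ q₂ → ParRel Finset.univ q₁ q₂ r → Den (.par p₁ p₂) r
  | parL (L : Finset A) (p₁ p₂ : CSPp A) (q₁ q₂ r : Proc A) :
      Den p₁ q₁ → Den p₂ q₂ → ParRel L q₁ q₂ r → Den (.parL L p₁ p₂) r

/-- Probabilistic ready trace equivalence `≈_O` on CSP_p terms. -/
def CSPEquiv (s t : CSPp A) : Prop :=
  ∀ ps pt : Proc A, Den s ps → Den t pt → RTEquiv ps pt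

end Proc

namespace CSPp

variable {A : Type}

/-- Well-formed CSP_p terms: distinct actions in external choices and
probabilities in (0,1] summing to one in probabilistic choices. -/
inductive WFt : CSPp A → Prop
  | delta : WFt .delta
  | ext (l : List (A × CSPp A)) :
      (l.map Prod.fst).Nodup → (∀ x ∈ l, WFt x.2) → WFt (.ext l)
  | prob (l : List (ℝ × CSPp A)) :
      (∀ x ∈ l, 0 < x.1 ∧ x.1 ≤ 1) → (l.map Prod.fst).sum = 1 →
      (∀ x ∈ l, WFt x.2) → WFt (.prob l)
  | theta (p : CSPp A) : WFt p → WFt (.theta p)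
  | par (p q : CSPp A) : WFt p → WFt q → WFt (.par p q)
  | parL (L : Finset A) (p q : CSPp A) : WFt p → WFt q → WFt (.parL L p q)

end CSPp

namespace CSPp

/-- One-hole contexts of CSP_p. -/
inductive Ctx (A : Type) where
  | hole : Ctx A
  | ext : List (A × CSPp A) → A → Ctx A → List (A × CSPp A) → Ctx A
  | prob : List (ℝ × CSPp A) → ℝ → Ctx A → List (ℝ × CSPp A) → Ctx A
  | theta : Ctx A → Ctx A
  | parl : Ctx A → CSPp A → Ctx A
  | parr : CSPp A → Ctx A → Ctx A
  | parLl : Finset A → Ctx A → CSPp A → Ctx A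
  | parLr : Finset A → CSPp A → Ctx A → Ctx A

/-- Filling the hole of a context with a process. -/
def Ctx.fill {A : Type} : Ctx A → CSPp A → CSPp A
  | .hole, p => p
  | .ext pre a c suf, p => .ext (pre ++ (a, c.fill p) :: suf)
  | .prob pre w c suf, p => .prob (pre ++ (w, c.fill p) :: suf)
  | .theta c, p => .theta (c.fill p)
  | .parl c q, p => .par (c.fill p) q
  | .parr q c, p => .par q (c.fill p)
  | .parLl L c q, p => .parL L (c.fill p) q
  | .parLr L q c, p => .parL L q (c.fill p)

end CSPp

namespace Proc

section Observations

variable {A : Type}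

/-- Value of a functional of menus at a nondeterministic state, and `0` elsewhere. -/
def ndVal (f : List (A × Proc A) → ℝ) : Proc A → ℝ
  | nd l => f l
  | pr _ => 0

/-- Expectation of a functional of nondeterministic states. -/
noncomputable def lin (f : List (A × Proc A) → ℝ) : Proc A → ℝ
  | nd l => f l
  | pr l => (l.map fun x => x.1 * ndVal f x.2).sum

@[simp] lemma lin_nd (f : List (A × Proc A) → ℝ) (l : List (A × Proc A)) :
    lin f (nd l) = f l := rfl

lemma lin_pr (f : List (A × Proc A) → ℝ) (l : List (ℝ × Proc A)) :
    lin f (pr l) = (l.map fun x => x.1 * ndVal f x.2).sum := rfl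

lemma lin_zero (p : Proc A) : lin (fun _ => 0) p = 0 := by
  cases p with
  | nd l => rfl
  | pr l =>
    rw [lin_pr]
    apply List.sum_eq_zero
    intro y hy
    obtain ⟨x, -, rfl⟩ := List.mem_map.1 hy
    cases x.2 <;> simp [ndVal]

lemma lin_add (f g : List (A × Proc A) → ℝ) (p : Proc A) :
    lin (fun l => f l + g l) p = lin f p + lin g p := by
  cases p with
  | nd l => rfl
  | pr l =>
    simp only [lin_pr]
    rw [← List.sum_map_add]
    congr 2
    funext x
    cases x.2 <;> simp [ndVal, mul_add]

lemma lin_mul_left (c : ℝ) (f : List (A × Proc A) → ℝ) (p : Proc A) :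
    lin (fun l => c * f l) p = c * lin f p := by
  cases p with
  | nd l => rfl
  | pr l =>
    simp only [lin_pr]
    rw [← List.sum_map_mul_left]
    congr 2
    funext x
    cases x.2 <;> simp [ndVal, mul_left_comm]

lemma lin_mul_right (c : ℝ) (f : List (A × Proc A) → ℝ) (p : Proc A) :
    lin (fun l => f l * c) p = lin f p * c := by
  simp only [mul_comm _ c, lin_mul_left]

lemma lin_flatMap_pflat (f : List (A × Proc A) → ℝ) (m : List (ℝ × Proc A)) :
    lin f (pr (m.flatMap pflat)) = (m.map fun x => x.1 * lin f x.2).sum := by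
  induction m with
  | nil => rfl
  | cons x m ih =>
    rw [lin_pr] at ih ⊢
    rw [List.flatMap_cons, List.map_append, List.sum_append, ih, List.map_cons, List.sum_cons]
    congr 1
    obtain ⟨r, p⟩ := x
    cases p with
    | nd l => simp [pflat, ndVal]
    | pr l =>
      simp only [pflat, lin_pr, List.map_map]
      rw [← List.sum_map_mul_left]
      congr 2
      funext x
      simp [mul_assoc]

variable [DecidableEq A]

/-- Probability of observing the menus of a ready trace when performing its actions. -/
noncomputable def obs : List (Finset A × A) → Finset A → Proc A → ℝ
  | [], M => lin fun l => if menu (nd l) = M then 1 else 0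
  | (N, a) :: t, M =>
      lin fun l => if menu (nd l) = N then (step (nd l) a).elim 0 (obs t M) else 0

lemma obs_eq_lin (t : List (Finset A × A)) (M : Finset A) (p : Proc A) :
    obs t M p = lin (fun l => obs t M (nd l)) p := by
  cases t <;> rfl

lemma obs_flatMap_pflat (t : List (Finset A × A)) (M : Finset A) (m : List (ℝ × Proc A)) :
    obs t M (pr (m.flatMap pflat)) = (m.map fun x => x.1 * obs t M x.2).sum := by
  rw [obs_eq_lin, lin_flatMap_pflat]
  congr 2
  funext x
  rw [← obs_eq_lin]

lemma obs_pr (t : List (Finset A × A)) (M : Finset A) (l : List (ℝ × Proc A)) :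
    obs t M (pr l) = (l.map fun x => x.1 * ndVal (fun k => obs t M (nd k)) x.2).sum := by
  rw [obs_eq_lin, lin_pr]

lemma mem_menu_iff (l : List (A × Proc A)) (a : A) :
    a ∈ menu (nd l) ↔ (step (nd l) a).isSome := by
  simp [menu, step]

lemma step_filter (P : A → Bool) (l : List (A × Proc A)) (a : A) :
    step (nd (l.filter fun x => P x.1)) a = if P a then step (nd l) a else none := by
  simp only [step, List.find?_filter]
  induction l with
  | nil => simp
  | cons x l ih =>
    by_cases h : x.1 = a
    · cases hP : P a
      · simpa [h, hP] using ih
      · simp [h, hP]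
    · cases hP : P a
      · simpa [h, hP] using ih
      · simpa [h, hP] using ih

lemma step_append (l m : List (A × Proc A)) (a : A) :
    step (nd (l ++ m)) a = (step (nd l) a).or (step (nd m) a) := by
  simp only [step, List.find?_append]
  cases List.find? (fun x => decide (x.1 = a)) l <;> simp

lemma step_cons (b : A) (p : Proc A) (l : List (A × Proc A)) (a : A) :
    step (nd ((b, p) :: l)) a = if b = a then some p else step (nd l) a := by
  by_cases h : b = a <;> simp [step, h]

lemma step_forall₂ {R : A → Proc A → Proc A → Prop} {l m : List (A × Proc A)}
    (h : List.Forall₂ (fun x y => y.1 = x.1 ∧ R x.1 x.2 y.2) l m) (a : A) :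
    Option.Rel (R a) (step (nd l) a) (step (nd m) a) := by
  induction h with
  | nil => exact .none
  | @cons x y l m hxy _ ih =>
    obtain ⟨b, p⟩ := x
    obtain ⟨c, q⟩ := y
    obtain ⟨rfl, h⟩ := hxy
    simp only at h
    rw [step_cons, step_cons]
    split_ifs with hc
    · subst hc
      exact .some h
    · exact ih

end Observations

lemma forall₂_of_get {α β : Type*} {R : α → β → Prop} {l : List α} {m : List β}
    (hl : m.length = l.length)
    (h : ∀ i (hi : i < l.length) (hi' : i < m.length), R (l.get ⟨i, hi⟩) (m.get ⟨i, hi'⟩)) :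
    List.Forall₂ R l m :=
  List.forall₂_iff_get.2 ⟨hl.symm, h⟩

lemma forall₂_unique {α β : Type*} {R S : α → β → Prop} {l : List α} {m m' : List β}
    (hRS : ∀ x y y', R x y → S x y' → y = y')
    (h : List.Forall₂ R l m) (h' : List.Forall₂ S l m') : m = m' := by
  induction h generalizing m' with
  | nil => cases h'; rfl
  | cons hx _ ih =>
    cases h' with
    | cons hx' ht' => rw [hRS _ _ _ hx hx', ih ht']

section Functional

variable {A : Type}

lemma ThetaRel.unique [LT A] [DecidableRel ((· < ·) : A → A → Prop)] {p q q' : Proc A}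
    (h : ThetaRel p q) (h' : ThetaRel p q') : q = q' := by
  induction h generalizing q' with
  | nd l m hl hk _ ih =>
    cases h' with
    | nd _ n hl' hk' hr' =>
      exact congrArg Proc.nd <| List.ext_get (hl.trans hl'.symm) fun i hi hi' =>
        Prod.ext ((hk i (hl ▸ hi) hi).trans (hk' i (hl ▸ hi) hi').symm)
          (ih i (hl ▸ hi) hi (hr' i (hl ▸ hi) hi'))
  | pr l m hl hk _ ih =>
    cases h' with
    | pr _ n hl' hk' hr' =>
      exact congrArg Proc.pr <| List.ext_get (hl.trans hl'.symm) fun i hi hi' =>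
        Prod.ext ((hk i (hl ▸ hi) hi).trans (hk' i (hl ▸ hi) hi').symm)
          (ih i (hl ▸ hi) hi (hr' i (hl ▸ hi) hi'))

variable [DecidableEq A]

lemma ParRel.unique {L : Finset A} {p q r r' : Proc A}
    (h : ParRel L p q r) (h' : ParRel L p q r') : r = r' := by
  induction h generalizing r' with
  | ndnd l l' m₁ m₂ m₃ h1 k1 _ h2 k2 _ h3 k3 _ i1 i2 i3 =>
    cases h' with
    | ndnd _ _ n₁ n₂ n₃ h1' k1' r1' h2' k2' r2' h3' k3' r3' =>
      have e1 : m₁ = n₁ := by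
        refine List.ext_get (h1.trans h1'.symm) fun i hi hi' => ?_
        have hi0 : i < (syncBranches L l l').length := h1 ▸ hi
        refine Prod.ext ((k1 i hi0 hi).trans (k1' i hi0 hi').symm) ?_
        have hs : (step (nd l') ((syncBranches L l l').get ⟨i, hi0⟩).1).isSome := by
          have := List.get_mem (syncBranches L l l') ⟨i, hi0⟩
          have := (List.mem_filter.1 this).2
          simp only [Bool.and_eq_true] at this
          exact this.2
        obtain ⟨q', hq'⟩ := Option.isSome_iff_exists.1 hs
        exact i1 i hi0 hi q' hq' (r1' i hi0 hi' q' hq')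
      have e2 : m₂ = n₂ := List.ext_get (h2.trans h2'.symm) fun i hi hi' =>
        Prod.ext ((k2 i (h2 ▸ hi) hi).trans (k2' i (h2 ▸ hi) hi').symm)
          (i2 i (h2 ▸ hi) hi (r2' i (h2 ▸ hi) hi'))
      have e3 : m₃ = n₃ := List.ext_get (h3.trans h3'.symm) fun i hi hi' =>
        Prod.ext ((k3 i (h3 ▸ hi) hi).trans (k3' i (h3 ▸ hi) hi').symm)
          (i3 i (h3 ▸ hi) hi (r3' i (h3 ▸ hi) hi'))
      rw [e1, e2, e3]
  | prnd l q m hq hl hk _ ih =>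
    cases h' with
    | prnd _ _ n _ hl' hk' hr' =>
      exact congrArg pr <| List.ext_get (hl.trans hl'.symm) fun i hi hi' =>
        Prod.ext ((hk i (hl ▸ hi) hi).trans (hk' i (hl ▸ hi) hi').symm)
          (ih i (hl ▸ hi) hi (hr' i (hl ▸ hi) hi'))
    | ndpr _ _ _ h => exact absurd rfl (h l)
    | prpr _ l' => exact absurd rfl (hq l')
  | ndpr q l' m hq hl hk _ ih =>
    cases h' with
    | ndpr _ _ n _ hl' hk' hr' =>
      exact congrArg pr <| List.ext_get (hl.trans hl'.symm) fun i hi hi' =>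
        Prod.ext ((hk i (hl ▸ hi) hi).trans (hk' i (hl ▸ hi) hi').symm)
          (ih i (hl ▸ hi) hi (hr' i (hl ▸ hi) hi'))
    | prnd _ _ _ h => exact absurd rfl (h l')
    | prpr l _ => exact absurd rfl (hq l)
  | prpr l l' m hl hk _ ih =>
    cases h' with
    | prpr _ _ n hl' hk' hr' =>
      exact congrArg pr <| List.ext_get (hl.trans hl'.symm) fun i hi hi' =>
        Prod.ext ((hk i (hl ▸ hi) hi).trans (hk' i (hl ▸ hi) hi').symm)
          (ih i (hl ▸ hi) hi (hr' i (hl ▸ hi) hi'))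
    | prnd _ _ _ h => exact absurd rfl (h l')
    | ndpr _ _ _ h => exact absurd rfl (h l)

variable [LT A] [DecidableRel ((· < ·) : A → A → Prop)]

variable [Fintype A]

lemma Den.unique {p : CSPp A} {q q' : Proc A} (h : Den p q) (h' : Den p q') : q = q' := by
  induction h generalizing q' with
  | delta => cases h'; rfl
  | ext l m hl hk _ ih =>
    cases h' with
    | ext _ n hl' hk' hr' =>
      exact congrArg Proc.nd <| List.ext_get (hl.trans hl'.symm) fun i hi hi' =>
        Prod.ext ((hk i (hl ▸ hi) hi).trans (hk' i (hl ▸ hi) hi').symm)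
          (ih i (hl ▸ hi) hi (hr' i (hl ▸ hi) hi'))
  | prob l m hl hk _ ih =>
    cases h' with
    | prob _ n hl' hk' hr' =>
      exact congrArg (fun m => Proc.pr (m.flatMap pflat)) <|
        List.ext_get (hl.trans hl'.symm) fun i hi hi' =>
          Prod.ext ((hk i (hl ▸ hi) hi).trans (hk' i (hl ▸ hi) hi').symm)
            (ih i (hl ▸ hi) hi (hr' i (hl ▸ hi) hi'))
  | theta p q r _ hr ih =>
    cases h' with
    | theta _ q' _ hq' hr' =>
      obtain rfl := ih hq'
      exact hr.unique hr'
  | par p₁ p₂ q₁ q₂ r _ _ hr i1 i2 =>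
    cases h' with
    | par _ _ q₁' q₂' _ d1 d2 hr' =>
      obtain rfl := i1 d1
      obtain rfl := i2 d2
      exact hr.unique hr'
  | parL L p₁ p₂ q₁ q₂ r _ _ hr i1 i2 =>
    cases h' with
    | parL _ _ _ q₁' q₂' _ d1 d2 hr' =>
      obtain rfl := i1 d1
      obtain rfl := i2 d2
      exact hr.unique hr'

end Functional

section Functionals

variable {A : Type} [DecidableEq A]

/-- The residual of a nondeterministic state: it is required to have the given menu, and performs
the given action, if any. -/
def residual (o : Finset A × Option A) (l : List (A × Proc A)) : Option (Proc A) :=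
  if menu (nd l) = o.1 then o.2.elim (some (nd l)) (step (nd l)) else none

/-- Pull a functional back along residuals. -/
noncomputable def pull (o : Finset A × Option A) (f : Proc A → ℝ) : Proc A → ℝ :=
  lin fun l => (residual o l).elim 0 f

lemma pull_some_obs (N : Finset A) (a : A) (t : List (Finset A × A)) (M : Finset A) :
    pull (N, some a) (obs t M) = obs ((N, a) :: t) M := by
  change lin _ = lin _
  congr 1
  funext l
  unfold residual
  split_ifs <;> rfl

lemma pull_none_obs (N : Finset A) (t : List (Finset A × A)) (M : Finset A) :
    pull (N, none) (obs t M) = 0 ∨ pull (N, none) (obs t M) = obs t M := by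
  have key (K : Finset A) (hK : ∀ l, menu (nd l) ≠ K → obs t M (nd l) = 0) :
      pull (N, none) (obs t M) = 0 ∨ pull (N, none) (obs t M) = obs t M := by
    by_cases h : K = N
    · right
      funext p
      rw [obs_eq_lin t M p]
      unfold pull
      congr 1
      funext l
      by_cases hl : menu (nd l) = N
      · simp [residual, hl]
      · simp [residual, hl, hK l (h ▸ hl)]
    · left
      funext p
      refine Eq.trans ?_ (lin_zero p)
      unfold pull
      congr 1
      funext l
      by_cases hl : menu (nd l) = N
      · simp [residual, hl, hK l (fun h' => h (h'.symm.trans hl))]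
      · simp [residual, hl]
  cases t with
  | nil => exact key M fun l hl => by simp [obs, hl]
  | cons x t => exact key x.1 fun l hl => by simp [obs, hl]

lemma pull_obs (o : Finset A × Option A) (t : List (Finset A × A)) (M : Finset A) :
    pull o (obs t M) = 0 ∨ ∃ t' M', pull o (obs t M) = obs t' M' := by
  obtain ⟨N, _ | a⟩ := o
  · exact (pull_none_obs N t M).imp_right fun h => ⟨t, M, h⟩
  · exact .inr ⟨_, _, pull_some_obs N a t M⟩

/-- Functionals spanned by ready trace observations. -/
def obsSpan (A : Type) [DecidableEq A] : Submodule ℝ (Proc A → ℝ) :=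
  Submodule.span ℝ {f | ∃ t M, f = obs t M}

/-- Functionals of pairs spanned by products of ready trace observations. -/
def obsSpan₂ (A : Type) [DecidableEq A] : Submodule ℝ (Proc A → Proc A → ℝ) :=
  Submodule.span ℝ {F | ∃ t M t' M', F = fun p q => obs t M p * obs t' M' q}

lemma obs_mem_obsSpan (t : List (Finset A × A)) (M : Finset A) : obs t M ∈ obsSpan A :=
  Submodule.subset_span ⟨t, M, rfl⟩

lemma obs_mul_obs_mem_obsSpan₂ (t : List (Finset A × A)) (M : Finset A)
    (t' : List (Finset A × A)) (M' : Finset A) :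
    (fun p q => obs t M p * obs t' M' q) ∈ obsSpan₂ A :=
  Submodule.subset_span ⟨t, M, t', M', rfl⟩

lemma pull_zero (o : Finset A × Option A) : pull o 0 = 0 := by
  funext p
  refine Eq.trans ?_ (lin_zero p)
  unfold pull
  congr 1
  funext l
  cases residual o l <;> rfl

lemma pull_add (o : Finset A × Option A) (f g : Proc A → ℝ) :
    pull o (f + g) = pull o f + pull o g := by
  funext p
  refine Eq.trans ?_ (lin_add _ _ p)
  unfold pull
  congr 1
  funext l
  cases residual o l <;> simp

lemma pull_smul (o : Finset A × Option A) (c : ℝ) (f : Proc A → ℝ) :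
    pull o (c • f) = c • pull o f := by
  funext p
  refine Eq.trans ?_ (lin_mul_left c _ p)
  unfold pull
  congr 1
  funext l
  cases residual o l <;> simp

lemma pull_mem_obsSpan (o : Finset A × Option A) {f : Proc A → ℝ} (hf : f ∈ obsSpan A) :
    pull o f ∈ obsSpan A := by
  induction hf using Submodule.span_induction with
  | mem f h =>
    obtain ⟨t, M, rfl⟩ := h
    obtain h | ⟨t', M', h⟩ := pull_obs o t M
    · rw [h]; exact zero_mem _
    · rw [h]; exact obs_mem_obsSpan t' M'
  | zero => rw [pull_zero]; exact zero_mem _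
  | add f g _ _ hf hg => rw [pull_add]; exact add_mem hf hg
  | smul c f _ hf => rw [pull_smul]; exact Submodule.smul_mem _ c hf

/-- Pull a functional of pairs back along residuals in both arguments. -/
noncomputable def pull₂ (o o' : Finset A × Option A) (F : Proc A → Proc A → ℝ) :
    Proc A → Proc A → ℝ :=
  fun p q => pull o (fun p' => pull o' (F p') q) p

lemma pull₂_add (o o' : Finset A × Option A) (F G : Proc A → Proc A → ℝ) :
    pull₂ o o' (F + G) = pull₂ o o' F + pull₂ o o' G := by
  funext p q
  simp only [pull₂, Pi.add_apply, pull_add]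
  exact congrFun (pull_add o (fun p' => pull o' (F p') q) fun p' => pull o' (G p') q) p

lemma pull₂_smul (o o' : Finset A × Option A) (c : ℝ) (F : Proc A → Proc A → ℝ) :
    pull₂ o o' (c • F) = c • pull₂ o o' F := by
  funext p q
  simp only [pull₂, Pi.smul_apply, pull_smul]
  exact congrFun (pull_smul o c fun p' => pull o' (F p') q) p

lemma pull₂_mul (o o' : Finset A × Option A) (f g : Proc A → ℝ) :
    pull₂ o o' (fun p q => f p * g q) = fun p q => pull o f p * pull o' g q := by
  funext p q
  have h (p' : Proc A) : pull o' (fun q' => f p' * g q') q = f p' * pull o' g q :=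
    congrFun (pull_smul o' (f p') g) q
  simp only [pull₂, h]
  rw [mul_comm]
  simp only [mul_comm _ (pull o' g q)]
  exact congrFun (pull_smul o (pull o' g q) f) p

lemma pull₂_mem_obsSpan₂ (o o' : Finset A × Option A) {F : Proc A → Proc A → ℝ}
    (hF : F ∈ obsSpan₂ A) : pull₂ o o' F ∈ obsSpan₂ A := by
  induction hF using Submodule.span_induction with
  | mem f h =>
    obtain ⟨t, M, t', M', rfl⟩ := h
    rw [pull₂_mul]
    obtain h | ⟨s, N, h⟩ := pull_obs o t M
    · simp only [h, Pi.zero_apply, zero_mul]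
      exact zero_mem _
    obtain h' | ⟨s', N', h'⟩ := pull_obs o' t' M'
    · simp only [h', Pi.zero_apply, mul_zero]
      exact zero_mem _
    rw [h, h']
    exact obs_mul_obs_mem_obsSpan₂ s N s' N'
  | zero =>
    have := pull₂_smul o o' 0 (0 : Proc A → Proc A → ℝ)
    rw [zero_smul, zero_smul] at this
    rw [this]
    exact zero_mem _
  | add f g _ _ hf hg => rw [pull₂_add]; exact add_mem hf hg
  | smul c f _ hf => rw [pull₂_smul]; exact Submodule.smul_mem _ c hf

lemma eq_lin_of_mem_obsSpan {f : Proc A → ℝ} (hf : f ∈ obsSpan A) (p : Proc A) :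
    f p = lin (fun l => f (nd l)) p := by
  induction hf using Submodule.span_induction with
  | mem f h =>
    obtain ⟨t, M, rfl⟩ := h
    exact obs_eq_lin t M p
  | zero => exact (lin_zero p).symm
  | add f g _ _ hf hg =>
    simp only [Pi.add_apply]
    rw [lin_add, ← hf, ← hg]
  | smul c f _ hf =>
    simp only [Pi.smul_apply, smul_eq_mul]
    rw [lin_mul_left, ← hf]

lemma eq_lin_of_mem_obsSpan₂ {F : Proc A → Proc A → ℝ} (hF : F ∈ obsSpan₂ A) (p q : Proc A) :
    F p q = lin (fun l => lin (fun l' => F (nd l) (nd l')) q) p := by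
  induction hF using Submodule.span_induction with
  | mem F h =>
    obtain ⟨t, M, t', M', rfl⟩ := h
    simp only [lin_mul_left, lin_mul_right, ← obs_eq_lin]
  | zero =>
    simp only [Pi.zero_apply, lin_zero]
  | add F G _ _ hF hG =>
    simp only [Pi.add_apply]
    rw [hF, hG, ← lin_add]
    simp only [lin_add]
  | smul c F _ hF =>
    simp only [Pi.smul_apply, smul_eq_mul, lin_mul_left]
    rw [← hF]

/-- A linear relation between observations persists for all spanned functionals. -/
lemma mem_obsSpan_apply_eq_sum {ι : Type*} [Fintype ι] {w : ι → ℝ} {p : Proc A} {x : ι → Proc A}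
    (h : ∀ t M, obs t M p = ∑ i, w i * obs t M (x i)) {f : Proc A → ℝ} (hf : f ∈ obsSpan A) :
    f p = ∑ i, w i * f (x i) := by
  induction hf using Submodule.span_induction with
  | mem f h' =>
    obtain ⟨t, M, rfl⟩ := h'
    exact h t M
  | zero => simp
  | add f g _ _ hf hg => simp [hf, hg, mul_add, Finset.sum_add_distrib]
  | smul c f _ hf => simp [hf, Finset.mul_sum, mul_left_comm]

lemma mem_obsSpan_of_mem_obsSpan₂_left {F : Proc A → Proc A → ℝ} (hF : F ∈ obsSpan₂ A)
    (q : Proc A) : (fun p => F p q) ∈ obsSpan A := by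
  induction hF using Submodule.span_induction with
  | mem F h =>
    obtain ⟨t, M, t', M', rfl⟩ := h
    convert Submodule.smul_mem _ (obs t' M' q) (obs_mem_obsSpan t M) using 1
    funext p
    simp [mul_comm]
  | zero => exact zero_mem _
  | add F G _ _ hF hG => exact add_mem hF hG
  | smul c F _ hF => exact Submodule.smul_mem _ c hF

lemma mem_obsSpan_of_mem_obsSpan₂_right {F : Proc A → Proc A → ℝ} (hF : F ∈ obsSpan₂ A)
    (p : Proc A) : F p ∈ obsSpan A := by
  induction hF using Submodule.span_induction with
  | mem F h =>
    obtain ⟨t, M, t', M', rfl⟩ := h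
    exact Submodule.smul_mem _ (obs t M p) (obs_mem_obsSpan t' M')
  | zero => exact zero_mem _
  | add F G _ _ hF hG => exact add_mem hF hG
  | smul c F _ hF => exact Submodule.smul_mem _ c hF

lemma obs_nd_append_cons_eq_sum {ι : Type*} [Fintype ι] {w : ι → ℝ} (hw : ∑ i, w i = 1)
    (pre suf : List (A × Proc A)) (b : A) {p : Proc A} {x : ι → Proc A}
    (h : ∀ t M, obs t M p = ∑ i, w i * obs t M (x i)) (t : List (Finset A × A)) (M : Finset A) :
    obs t M (nd (pre ++ (b, p) :: suf)) =
      ∑ i, w i * obs t M (nd (pre ++ (b, x i) :: suf)) := by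
  have hmenu (q : Proc A) : menu (nd (pre ++ (b, q) :: suf)) =
      menu (nd (pre ++ (b, nd []) :: suf)) := by
    simp [menu]
  cases t with
  | nil =>
    simp only [obs, lin_nd, hmenu p, fun i => hmenu (x i)]
    rw [← Finset.sum_mul, hw, one_mul]
  | cons y t =>
    simp only [obs, lin_nd, hmenu p, fun i => hmenu (x i), step_append, step_cons]
    split_ifs
    · cases step (nd pre) y.2 with
      | none => simpa using h t M
      | some q => simp [← Finset.sum_mul, hw]
    · cases step (nd pre) y.2 <;> simp [← Finset.sum_mul, hw]
    · simp

end Functionals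

lemma sum_map_eq_of_forall₂ {α β : Type*} {f : α → ℝ} {g : β → ℝ} {l : List α} {m : List β}
    (h : List.Forall₂ (fun x y => g y = f x) l m) : (m.map g).sum = (l.map f).sum := by
  induction h with
  | nil => rfl
  | cons h _ ih => simp [h, ih]

section Priority

variable {A : Type} [DecidableEq A] [LT A] [DecidableRel ((· < ·) : A → A → Prop)]

lemma obs_of_thetaRel {t : List (Finset A × A)} {M : Finset A} {f : Proc A → ℝ}
    (hf : f ∈ obsSpan A)
    (h : ∀ l m, ThetaRel (nd l) (nd m) → obs t M (nd m) = f (nd l)) {p q : Proc A}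
    (hpq : ThetaRel p q) : obs t M q = f p := by
  cases hpq with
  | nd l m hl hk hr => exact h l m (.nd l m hl hk hr)
  | pr l m hl hk hr =>
    rw [obs_pr, eq_lin_of_mem_obsSpan hf, lin_pr]
    refine sum_map_eq_of_forall₂ (forall₂_of_get hl fun i hi hi' => ?_)
    rw [hk i hi hi']
    congr 1
    have := hr i hi hi'
    revert this
    generalize (l.get ⟨i, hi⟩).2 = p
    generalize (m.get ⟨i, hi'⟩).2 = q
    intro hpq
    cases hpq with
    | nd l m hl hk hr => exact h l m (.nd l m hl hk hr)
    | pr => rfl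

/-- The actions of maximal priority in a menu. -/
def maxMenu (M : Finset A) : Finset A := M.filter fun a => ∀ b ∈ M, ¬ a < b

lemma step_maxBranches (l : List (A × Proc A)) (a : A) :
    step (nd (maxBranches l)) a = if a ∈ maxMenu (menu (nd l)) then step (nd l) a else none := by
  unfold maxBranches
  rw [step_filter (fun a => decide (¬ ∃ y ∈ l, a < y.1))]
  by_cases ha : a ∈ menu (nd l)
  · have : (¬ ∃ y ∈ l, a < y.1) ↔ a ∈ maxMenu (menu (nd l)) := by
      simp only [maxMenu, Finset.mem_filter, ha, true_and]
      simp only [menu, List.mem_toFinset, List.mem_map]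
      grind
    simp only [this, decide_eq_true_eq]
  · rw [mem_menu_iff, Option.not_isSome_iff_eq_none] at ha
    simp [ha]

lemma step_thetaRel {l m : List (A × Proc A)} (h : ThetaRel (nd l) (nd m)) (a : A) :
    Option.Rel ThetaRel (if a ∈ maxMenu (menu (nd l)) then step (nd l) a else none)
      (step (nd m) a) := by
  cases h with
  | nd _ _ hl hk hr =>
    rw [← step_maxBranches]
    exact step_forall₂ (R := fun _ => ThetaRel)
      (forall₂_of_get hl fun i hi hi' => ⟨hk i hi hi', hr i hi hi'⟩) a

lemma _root_.Option.Rel.isSome_eq {α β : Type*} {R : α → β → Prop} {x : Option α} {y : Option β}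
    (h : Option.Rel R x y) : x.isSome = y.isSome := by
  cases h <;> rfl

lemma menu_thetaRel {l m : List (A × Proc A)} (h : ThetaRel (nd l) (nd m)) :
    menu (nd m) = maxMenu (menu (nd l)) := by
  ext a
  rw [mem_menu_iff, ← (step_thetaRel h a).isSome_eq]
  split_ifs with ha
  · simp [← mem_menu_iff, ha, (Finset.mem_filter.1 ha).1]
  · simp [ha]

variable [Fintype A]

lemma exists_obs_thetaRel (t : List (Finset A × A)) (M : Finset A) :
    ∃ f ∈ obsSpan A, ∀ p q, ThetaRel p q → obs t M q = f p := by
  induction t with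
  | nil =>
    have hmem : (∑ N, if maxMenu N = M then obs [] N else 0) ∈ obsSpan A := by
      refine Submodule.sum_mem _ fun N _ => ?_
      split_ifs
      exacts [obs_mem_obsSpan _ _, zero_mem _]
    refine ⟨_, hmem, fun p q => obs_of_thetaRel hmem ?_⟩
    intro l m h
    rw [Finset.sum_apply, Finset.sum_eq_single (menu (nd l))]
    · simp only [obs, lin_nd, menu_thetaRel h]
      split_ifs <;> simp
    · intro N _ hN
      split_ifs <;> simp [obs, hN.symm]
    · simp
  | cons x t ih =>
    obtain ⟨N, a⟩ := x
    obtain ⟨f, hf, h⟩ := ih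
    have hmem : (∑ K, if maxMenu K = N ∧ a ∈ N then pull (K, some a) f else 0) ∈ obsSpan A := by
      refine Submodule.sum_mem _ fun K _ => ?_
      split_ifs
      exacts [pull_mem_obsSpan _ hf, zero_mem _]
    refine ⟨_, hmem, fun p q => obs_of_thetaRel hmem ?_⟩
    intro l m hlm
    rw [Finset.sum_apply, Finset.sum_eq_single (menu (nd l))]
    · have hs := step_thetaRel hlm a
      simp only [obs, lin_nd, menu_thetaRel hlm]
      by_cases hN : maxMenu (menu (nd l)) = N
      · simp only [hN, true_and, if_true] at hs ⊢
        by_cases ha : a ∈ N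
        · simp only [ha, if_true, pull, lin_nd, residual, Option.elim_some] at hs ⊢
          revert hs
          generalize step (nd l) a = u
          generalize step (nd m) a = v
          intro hs
          cases hs with
          | none => rfl
          | some hpq => exact h _ _ hpq
        · simp only [ha, if_false] at hs ⊢
          revert hs
          generalize step (nd m) a = v
          intro hs
          cases hs
          rfl
      · simp [hN]
    · intro K _ hK
      split_ifs <;> simp [pull, residual, hK.symm]
    · simp

end Priority

section Parallel

variable {A : Type} [DecidableEq A] {L : Finset A}

lemma obs_of_parRel {t : List (Finset A × A)} {M : Finset A} {F : Proc A → Proc A → ℝ}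
    (hF : F ∈ obsSpan₂ A)
    (h : ∀ l l' m, ParRel L (nd l) (nd l') (nd m) → obs t M (nd m) = F (nd l) (nd l'))
    {p q r : Proc A} (hpq : ParRel L p q r) : obs t M r = F p q := by
  have key {p q r : Proc A} (hr : ParRel L p q r) : ndVal (fun k => obs t M (nd k)) r =
      ndVal (fun l => ndVal (fun l' => F (nd l) (nd l')) q) p := by
    cases hr with
    | ndnd l l' m₁ m₂ m₃ h1 k1 r1 h2 k2 r2 h3 k3 r3 =>
      exact h l l' _ (.ndnd l l' m₁ m₂ m₃ h1 k1 r1 h2 k2 r2 h3 k3 r3)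
    | prnd => rfl
    | ndpr => cases p <;> rfl
    | prpr => rfl
  cases hpq with
  | ndnd l l' m₁ m₂ m₃ h1 k1 r1 h2 k2 r2 h3 k3 r3 =>
    exact h l l' _ (.ndnd l l' m₁ m₂ m₃ h1 k1 r1 h2 k2 r2 h3 k3 r3)
  | prnd l _ m hq hl hk hr =>
    cases q with
    | pr l' => exact absurd rfl (hq l')
    | nd l' =>
      rw [obs_pr, eq_lin_of_mem_obsSpan₂ hF, lin_pr]
      refine sum_map_eq_of_forall₂ (forall₂_of_get hl fun i hi hi' => ?_)
      rw [hk i hi hi', key (hr i hi hi')]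
      rfl
  | ndpr _ l' m hq hl hk hr =>
    cases p with
    | pr l => exact absurd rfl (hq l)
    | nd l =>
      rw [obs_pr, eq_lin_of_mem_obsSpan₂ hF, lin_nd, lin_pr]
      refine sum_map_eq_of_forall₂ (forall₂_of_get hl fun i hi hi' => ?_)
      rw [hk i hi hi', key (hr i hi hi')]
      rfl
  | prpr l l' m hl hk hr =>
    rw [obs_pr, eq_lin_of_mem_obsSpan₂ hF, lin_pr]
    rw [sum_map_eq_of_forall₂ (l := l.flatMap fun x => l'.map fun x' => (x, x'))
      (f := fun z => z.1.1 * z.2.1 *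
        ndVal (fun l => ndVal (fun l' => F (nd l) (nd l')) z.2.2) z.1.2)]
    · clear hl hk hr
      induction l with
      | nil => rfl
      | cons x l ih =>
        rw [List.flatMap_cons, List.map_append, List.sum_append, ih, List.map_cons, List.sum_cons,
          List.map_map]
        congr 1
        obtain ⟨w, p⟩ := x
        cases p with
        | pr k =>
          simp only [ndVal, mul_zero]
          exact List.sum_eq_zero fun y hy => by
            obtain ⟨z, -, rfl⟩ := List.mem_map.1 hy
            simp
        | nd k =>
          simp only [ndVal, lin_pr]
          rw [← List.sum_map_mul_left]
          congr 2
          funext z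
          simp [mul_assoc]
    · refine forall₂_of_get hl fun i hi hi' => ?_
      rw [hk i hi hi', key (hr i hi hi')]

/-- The components of a parallel composition after an action. If the action can be performed
independently by both components, then the left one moves. -/
def parStep (L : Finset A) (l l' : List (A × Proc A)) (a : A) : Option (Proc A × Proc A) :=
  if a ∈ L then (step (nd l) a).bind fun p => (step (nd l') a).map fun q => (p, q)
  else ((step (nd l) a).map fun p => (p, nd l')).or ((step (nd l') a).map fun q => (nd l, q))

lemma step_parRel {l l' m : List (A × Proc A)} (h : ParRel L (nd l) (nd l') (nd m)) (a : A) :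
    Option.Rel (fun x => ParRel L x.1 x.2) (parStep L l l' a) (step (nd m) a) := by
  cases h with
  | ndnd _ _ m₁ m₂ m₃ h1 k1 r1 h2 k2 r2 h3 k3 r3 =>
    have s1 := step_forall₂
      (R := fun b p r => ∀ q', step (nd l') b = some q' → ParRel L p q' r)
      (forall₂_of_get h1 fun i hi hi' => ⟨k1 i hi hi', r1 i hi hi'⟩) a
    have s2 := step_forall₂ (R := fun _ p r => ParRel L p (nd l') r)
      (forall₂_of_get h2 fun i hi hi' => ⟨k2 i hi hi', r2 i hi hi'⟩) a
    have s3 := step_forall₂ (R := fun _ q r => ParRel L (nd l) q r)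
      (forall₂_of_get h3 fun i hi hi' => ⟨k3 i hi hi', r3 i hi hi'⟩) a
    simp only [syncBranches, freeBranches] at s1 s2 s3
    rw [step_filter (fun b => decide (b ∈ L) && (step (nd l') b).isSome)] at s1
    rw [step_filter (fun b => decide (b ∉ L))] at s2 s3
    rw [step_append, step_append]
    unfold parStep
    revert s1 s2 s3
    generalize step (nd l) a = u
    generalize step (nd l') a = u'
    generalize step (nd m₁) a = v₁
    generalize step (nd m₂) a = v₂
    generalize step (nd m₃) a = v₃
    intro s1 s2 s3
    by_cases ha : a ∈ L
    · simp only [ha, not_true, decide_false, decide_true, Bool.true_and, if_true] at s1 s2 s3 ⊢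
      simp only [Bool.false_eq_true, if_false] at s2 s3
      cases s2
      cases s3
      rcases u' with _ | q
      · simp only [Option.isSome_none, Bool.false_eq_true, if_false] at s1
        cases s1
        cases u <;> exact .none
      · simp only [Option.isSome_some, if_true] at s1
        cases s1 with
        | none => exact .none
        | some h => exact .some (h q rfl)
    · simp only [ha, not_false_iff, decide_false, decide_true, Bool.false_and,
        if_true] at s1 s2 s3 ⊢
      simp only [Bool.false_eq_true, if_false] at s1 ⊢
      cases s1
      cases s2 with
      | none =>
        cases s3 with
        | none => exact .none
        | some h => exact .some h
      | some h => exact .some h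

/-- The menu of a parallel composition. -/
def parMenu (L M N : Finset A) : Finset A := (M ∩ N ∩ L) ∪ (M \ L) ∪ (N \ L)

lemma menu_parRel {l l' m : List (A × Proc A)} (h : ParRel L (nd l) (nd l') (nd m)) :
    menu (nd m) = parMenu L (menu (nd l)) (menu (nd l')) := by
  ext a
  rw [mem_menu_iff, ← (step_parRel h a).isSome_eq]
  simp only [parMenu, Finset.mem_union, Finset.mem_inter, Finset.mem_sdiff, mem_menu_iff, parStep]
  split_ifs with ha <;> cases step (nd l) a <;> cases step (nd l') a <;> simp [ha]

lemma pull₂_nd (o o' : Finset A × Option A) (F : Proc A → Proc A → ℝ)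
    (l l' : List (A × Proc A)) :
    pull₂ o o' F (nd l) (nd l') =
      (residual o l).elim 0 fun p => (residual o' l').elim 0 fun q => F p q := rfl

lemma pull₂_nd_of_ne (o o' : Finset A × Option A) (F : Proc A → Proc A → ℝ)
    {l l' : List (A × Proc A)} (h : menu (nd l) ≠ o.1 ∨ menu (nd l') ≠ o'.1) :
    pull₂ o o' F (nd l) (nd l') = 0 := by
  rw [pull₂_nd]
  obtain h | h := h
  · simp [residual, h]
  · cases residual o l <;> simp [residual, h]

variable [Fintype A]

lemma exists_obs_parRel (L : Finset A) (t : List (Finset A × A)) (M : Finset A) :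
    ∃ F ∈ obsSpan₂ A, ∀ p q r, ParRel L p q r → obs t M r = F p q := by
  induction t with
  | nil =>
    have hmem : (∑ x : Finset A × Finset A, if parMenu L x.1 x.2 = M then
        (fun p q => obs [] x.1 p * obs [] x.2 q) else 0) ∈ obsSpan₂ A := by
      refine Submodule.sum_mem _ fun K _ => ?_
      split_ifs
      exacts [obs_mul_obs_mem_obsSpan₂ _ _ _ _, zero_mem _]
    refine ⟨_, hmem, fun p q r => obs_of_parRel hmem ?_⟩
    intro l l' m h
    rw [Finset.sum_apply, Finset.sum_apply, Finset.sum_eq_single (menu (nd l), menu (nd l'))]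
    · simp only [obs, lin_nd, menu_parRel h]
      split_ifs <;> simp
    · intro x _ hx
      split_ifs
      · by_cases h1 : menu (nd l) = x.1
        · have h2 : menu (nd l') ≠ x.2 := fun h2 => hx (Prod.ext h1.symm h2.symm)
          simp [obs, h2]
        · simp [obs, h1]
      · rfl
    · simp
  | cons x t ih =>
    obtain ⟨N, a⟩ := x
    obtain ⟨F, hF, h⟩ := ih
    have hmem : (∑ x : Finset A × Finset A, if parMenu L x.1 x.2 = N then
        if a ∈ L then pull₂ (x.1, some a) (x.2, some a) F
        else if a ∈ x.1 then pull₂ (x.1, some a) (x.2, none) F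
        else pull₂ (x.1, none) (x.2, some a) F else 0) ∈ obsSpan₂ A := by
      refine Submodule.sum_mem _ fun K _ => ?_
      split_ifs
      exacts [pull₂_mem_obsSpan₂ _ _ hF, pull₂_mem_obsSpan₂ _ _ hF, pull₂_mem_obsSpan₂ _ _ hF,
        zero_mem _]
    refine ⟨_, hmem, fun p q r => obs_of_parRel hmem ?_⟩
    intro l l' m hlm
    rw [Finset.sum_apply, Finset.sum_apply, Finset.sum_eq_single (menu (nd l), menu (nd l'))]
    · have hs := step_parRel hlm a
      simp only [obs, lin_nd, menu_parRel hlm]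
      by_cases hN : parMenu L (menu (nd l)) (menu (nd l')) = N
      · simp only [hN, if_true]
        have e : (step (nd m) a).elim 0 (obs t M) =
            (parStep L l l' a).elim 0 fun x => F x.1 x.2 := by
          revert hs
          generalize parStep L l l' a = u
          generalize step (nd m) a = v
          intro hs
          cases hs with
          | none => rfl
          | some hpq => exact h _ _ _ hpq
        rw [e, parStep]
        simp only [mem_menu_iff]
        split_ifs with ha hl <;> simp only [pull₂_nd, residual, if_true, Option.elim_some,
          Option.elim_none]
        · cases step (nd l) a <;> cases step (nd l') a <;> rfl
        · obtain ⟨p, hp⟩ := Option.isSome_iff_exists.1 hl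
          simp [hp]
        · rw [Option.not_isSome_iff_eq_none] at hl
          cases step (nd l') a <;> simp [hl]
      · simp [hN]
    · intro x _ hx
      have hne : menu (nd l) ≠ x.1 ∨ menu (nd l') ≠ x.2 := by
        by_contra! h'
        exact hx (Prod.ext h'.1.symm h'.2.symm)
      split_ifs
      exacts [pull₂_nd_of_ne _ _ _ hne, pull₂_nd_of_ne _ _ _ hne, pull₂_nd_of_ne _ _ _ hne, rfl]
    · simp

lemma obs_eq_sum_of_parRel_left {ι : Type*} [Fintype ι] {w : ι → ℝ} {L : Finset A}
    {p q r : Proc A} {x y : ι → Proc A} (h : ∀ t M, obs t M p = ∑ i, w i * obs t M (x i))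
    (hr : ParRel L p q r) (hy : ∀ i, ParRel L (x i) q (y i)) (t : List (Finset A × A))
    (M : Finset A) : obs t M r = ∑ i, w i * obs t M (y i) := by
  obtain ⟨F, hF, hobs⟩ := exists_obs_parRel L t M
  simp only [hobs _ _ _ hr, hobs _ _ _ (hy _)]
  exact mem_obsSpan_apply_eq_sum h (mem_obsSpan_of_mem_obsSpan₂_left hF q)

lemma obs_eq_sum_of_parRel_right {ι : Type*} [Fintype ι] {w : ι → ℝ} {L : Finset A}
    {p q r : Proc A} {x y : ι → Proc A} (h : ∀ t M, obs t M q = ∑ i, w i * obs t M (x i))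
    (hr : ParRel L p q r) (hy : ∀ i, ParRel L p (x i) (y i)) (t : List (Finset A × A))
    (M : Finset A) : obs t M r = ∑ i, w i * obs t M (y i) := by
  obtain ⟨F, hF, hobs⟩ := exists_obs_parRel L t M
  simp only [hobs _ _ _ hr, hobs _ _ _ (hy _)]
  exact mem_obsSpan_apply_eq_sum h (mem_obsSpan_of_mem_obsSpan₂_right hF p)

end Parallel

section Proper

variable {A : Type}

/-- Process graphs all of whose probabilistic transitions are nonempty and lead to
nondeterministic states. -/
inductive Proper : Proc A → Prop
  | nd (l : List (A × Proc A)) : (∀ x ∈ l, Proper x.2) → Proper (nd l)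
  | pr (l : List (ℝ × Proc A)) : l ≠ [] → (∀ x ∈ l, ∃ k, x.2 = Proc.nd k) →
      (∀ x ∈ l, Proper x.2) → Proper (pr l)

lemma Proper.of_mem_nd {l : List (A × Proc A)} (h : Proper (Proc.nd l)) :
    ∀ x ∈ l, Proper x.2 := by
  cases h with
  | nd _ h => exact h

lemma Proper.of_mem_pr {l : List (ℝ × Proc A)} (h : Proper (Proc.pr l)) :
    ∀ x ∈ l, Proper x.2 := by
  cases h with
  | pr _ _ _ h => exact h

lemma Proper.ne_nil {l : List (ℝ × Proc A)} (h : Proper (Proc.pr l)) : l ≠ [] := by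
  cases h with
  | pr _ h => exact h

lemma Proper.eq_nd_of_mem {l : List (ℝ × Proc A)} (h : Proper (Proc.pr l)) :
    ∀ x ∈ l, ∃ k, x.2 = Proc.nd k := by
  cases h with
  | pr _ _ h => exact h

lemma exists_mem_of_get {α β : Type*} {R : α → β → Prop} {l : List α} {m : List β}
    (hl : m.length = l.length)
    (h : ∀ i (hi : i < l.length) (hi' : i < m.length), R (l.get ⟨i, hi⟩) (m.get ⟨i, hi'⟩))
    {y : β} (hy : y ∈ m) : ∃ x ∈ l, R x y := by
  obtain ⟨⟨i, hi⟩, rfl⟩ := List.get_of_mem hy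
  exact ⟨_, List.get_mem l ⟨i, hl ▸ hi⟩, h i (hl ▸ hi) hi⟩

lemma ne_nil_of_length_eq {α β : Type*} {l : List α} {m : List β}
    (hl : m.length = l.length) (h : l ≠ []) : m ≠ [] := by
  rintro rfl
  exact h (List.length_eq_zero_iff.1 hl.symm)

lemma ThetaRel.proper [LT A] [DecidableRel ((· < ·) : A → A → Prop)] {p q : Proc A}
    (h : ThetaRel p q) (hp : Proper p) : Proper q := by
  induction h with
  | nd l m hl hk hr ih =>
    refine .nd _ fun y hy => ?_
    obtain ⟨x, hx, h⟩ := exists_mem_of_get (R := fun x y => Proper x.2 → Proper y.2) hl ih hy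
    exact h (hp.of_mem_nd x (List.mem_of_mem_filter hx))
  | pr l m hl hk hr ih =>
    refine .pr _ (ne_nil_of_length_eq hl hp.ne_nil) (fun y hy => ?_) fun y hy => ?_
    · obtain ⟨x, hx, h⟩ := exists_mem_of_get (R := fun x y => ThetaRel x.2 y.2) hl hr hy
      obtain ⟨k, hk⟩ := hp.eq_nd_of_mem x hx
      rw [hk] at h
      generalize y.2 = q at h
      cases h with
      | nd _ m => exact ⟨m, rfl⟩
    · obtain ⟨x, hx, h⟩ := exists_mem_of_get (R := fun x y => Proper x.2 → Proper y.2) hl ih hy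
      exact h (hp.of_mem_pr x hx)

lemma Proper.pr_flatMap_pflat {m : List (ℝ × Proc A)} (hm : m ≠ [])
    (h : ∀ y ∈ m, Proper y.2) : Proper (Proc.pr (m.flatMap pflat)) := by
  have key (y : ℝ × Proc A) (hy : Proper y.2) : Proper (Proc.pr (pflat y)) := by
    obtain ⟨r, p⟩ := y
    cases hy with
    | nd l hl =>
      refine .pr _ (by simp [pflat]) ?_ ?_
      · simp [pflat]
      · simpa [pflat] using Proper.nd l hl
    | pr l h1 h2 h3 =>
      refine .pr _ (by simpa [pflat] using h1) ?_ ?_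
      · simp only [pflat, List.mem_map]
        rintro _ ⟨x, hx, rfl⟩
        exact h2 x hx
      · simp only [pflat, List.mem_map]
        rintro _ ⟨x, hx, rfl⟩
        exact h3 x hx
  refine .pr _ ?_ (fun z hz => ?_) fun z hz => ?_
  · obtain ⟨y, hy⟩ := List.exists_mem_of_ne_nil _ hm
    obtain ⟨z, hz⟩ := List.exists_mem_of_ne_nil _ (key y (h y hy)).ne_nil
    exact List.ne_nil_of_mem (List.mem_flatMap.2 ⟨y, hy, hz⟩)
  · obtain ⟨y, hy, hz⟩ := List.mem_flatMap.1 hz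
    exact (key y (h y hy)).eq_nd_of_mem z hz
  · obtain ⟨y, hy, hz⟩ := List.mem_flatMap.1 hz
    exact (key y (h y hy)).of_mem_pr z hz

variable [DecidableEq A]

lemma Proper.step {l : List (A × Proc A)} (h : Proper (Proc.nd l)) {a : A} {q : Proc A}
    (hq : Proc.step (Proc.nd l) a = some q) : Proper q := by
  simp only [Proc.step, Option.map_eq_some_iff] at hq
  obtain ⟨x, hx, rfl⟩ := hq
  exact h.of_mem_nd x (List.mem_of_find?_eq_some hx)

lemma ParRel.exists_eq_nd {L : Finset A} {k k' : List (A × Proc A)} {r : Proc A}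
    (h : ParRel L (nd k) (nd k') r) : ∃ m, r = nd m := by
  cases h with
  | ndnd => exact ⟨_, rfl⟩

lemma ParRel.proper {L : Finset A} {p q r : Proc A}
    (h : ParRel L p q r) (hp : Proper p) (hq : Proper q) : Proper r := by
  induction h with
  | ndnd l l' m₁ m₂ m₃ h1 k1 _ h2 k2 _ h3 k3 _ i1 i2 i3 =>
    refine .nd _ fun y hy => ?_
    rcases List.mem_append.1 hy with hy | hy
    · rcases List.mem_append.1 hy with hy | hy
      · obtain ⟨x, hx, h⟩ := exists_mem_of_get (R := fun x y => ∀ q',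
          Proc.step (Proc.nd l') x.1 = some q' → Proper x.2 → Proper q' → Proper y.2) h1 i1 hy
        obtain ⟨hxl, hx⟩ := List.mem_filter.1 hx
        simp only [Bool.and_eq_true] at hx
        obtain ⟨q', hq'⟩ := Option.isSome_iff_exists.1 hx.2
        exact h q' hq' (hp.of_mem_nd x hxl) (hq.step hq')
      · obtain ⟨x, hx, h⟩ := exists_mem_of_get
          (R := fun x y => Proper x.2 → Proper (.nd l') → Proper y.2) h2 i2 hy
        exact h (hp.of_mem_nd x (List.mem_of_mem_filter hx)) hq
    · obtain ⟨x, hx, h⟩ := exists_mem_of_get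
        (R := fun x y => Proper (.nd l) → Proper x.2 → Proper y.2) h3 i3 hy
      exact h hp (hq.of_mem_nd x (List.mem_of_mem_filter hx))
  | prnd l q m hnd hl hk hr ih =>
    refine .pr _ (ne_nil_of_length_eq hl hp.ne_nil) (fun y hy => ?_) fun y hy => ?_
    · obtain ⟨x, hx, h⟩ := exists_mem_of_get (R := fun x y => ParRel L x.2 q y.2) hl hr hy
      obtain ⟨k, hk⟩ := hp.eq_nd_of_mem x hx
      cases q with
      | pr l' => exact absurd rfl (hnd l')
      | nd l' => exact ParRel.exists_eq_nd (hk ▸ h)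
    · obtain ⟨x, hx, h⟩ := exists_mem_of_get
        (R := fun x y => Proper x.2 → Proper q → Proper y.2) hl ih hy
      exact h (hp.of_mem_pr x hx) hq
  | ndpr p l m hnd hl hk hr ih =>
    refine .pr _ (ne_nil_of_length_eq hl hq.ne_nil) (fun y hy => ?_) fun y hy => ?_
    · obtain ⟨x, hx, h⟩ := exists_mem_of_get (R := fun x y => ParRel L p x.2 y.2) hl hr hy
      obtain ⟨k, hk⟩ := hq.eq_nd_of_mem x hx
      cases p with
      | pr l' => exact absurd rfl (hnd l')
      | nd l' => exact ParRel.exists_eq_nd (hk ▸ h)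
    · obtain ⟨x, hx, h⟩ := exists_mem_of_get
        (R := fun x y => Proper p → Proper x.2 → Proper y.2) hl ih hy
      exact h hp (hq.of_mem_pr x hx)
  | prpr l l' m hl hk hr ih =>
    refine .pr _ (ne_nil_of_length_eq hl ?_) (fun y hy => ?_) fun y hy => ?_
    · obtain ⟨x, hx⟩ := List.exists_mem_of_ne_nil _ hp.ne_nil
      obtain ⟨x', hx'⟩ := List.exists_mem_of_ne_nil _ hq.ne_nil
      exact List.ne_nil_of_mem (List.mem_flatMap.2 ⟨x, hx, List.mem_map.2 ⟨x', hx', rfl⟩⟩)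
    · obtain ⟨z, hz, h⟩ := exists_mem_of_get
        (R := fun z y => ParRel L z.1.2 z.2.2 y.2) hl hr hy
      obtain ⟨x, hx, hz⟩ := List.mem_flatMap.1 hz
      obtain ⟨x', hx', rfl⟩ := List.mem_map.1 hz
      obtain ⟨k, hk⟩ := hp.eq_nd_of_mem x hx
      obtain ⟨k', hk'⟩ := hq.eq_nd_of_mem x' hx'
      simp only [hk, hk'] at h
      exact h.exists_eq_nd
    · obtain ⟨z, hz, h⟩ := exists_mem_of_get
        (R := fun z y => Proper z.1.2 → Proper z.2.2 → Proper y.2) hl ih hy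
      obtain ⟨x, hx, hz⟩ := List.mem_flatMap.1 hz
      obtain ⟨x', hx', rfl⟩ := List.mem_map.1 hz
      exact h (hp.of_mem_pr x hx) (hq.of_mem_pr x' hx')

lemma Den.proper [LT A] [DecidableRel ((· < ·) : A → A → Prop)] [Fintype A] {p : CSPp A}
    {q : Proc A} (h : Den p q) (hp : p.WFt) : Proper q := by
  induction h with
  | delta => exact .nd _ (by simp)
  | ext l m hl hk hr ih =>
    cases hp with
    | ext _ _ hw =>
      refine .nd _ fun y hy => ?_
      obtain ⟨x, hx, h⟩ := exists_mem_of_get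
        (R := fun (x : A × CSPp A) (y : A × Proc A) => x.2.WFt → Proper y.2) hl ih hy
      exact h (hw x hx)
  | prob l m hl hk hr ih =>
    cases hp with
    | prob _ _ hs hw =>
      refine Proper.pr_flatMap_pflat (ne_nil_of_length_eq hl ?_) fun y hy => ?_
      · rintro rfl
        simp at hs
      · obtain ⟨x, hx, h⟩ := exists_mem_of_get
          (R := fun (x : ℝ × CSPp A) (y : ℝ × Proc A) => x.2.WFt → Proper y.2) hl ih hy
        exact h (hw x hx)
  | theta p q q' _ hr ih =>
    cases hp with
    | theta _ hp => exact hr.proper (ih hp)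
  | par p₁ p₂ q₁ q₂ r _ _ hr i1 i2 =>
    cases hp with
    | par _ _ h1 h2 => exact hr.proper (i1 h1) (i2 h2)
  | parL L p₁ p₂ q₁ q₂ r _ _ hr i1 i2 =>
    cases hp with
    | parL _ _ _ h1 h2 => exact hr.proper (i1 h1) (i2 h2)

lemma Proper.P1_eq {s : Proc A} (hs : Proper s) (M : Finset A) : P1 s M = obs [] M s := by
  cases hs with
  | nd l => rw [P1]; rfl
  | pr l h1 h2 h3 =>
    have e : (l.attach.map fun x => x.1.1 * P1 x.1.2 M) =
        l.map fun x => x.1 * P1 x.2 M :=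
      List.attach_map_val (f := fun x : ℝ × Proc A => x.1 * P1 x.2 M)
    rw [P1, e, obs_pr]
    congr 1
    refine List.map_congr_left fun x hx => ?_
    obtain ⟨k, hk⟩ := h2 x hx
    rw [hk, P1]
    rfl

/-- The branches of a probabilistic state after a menu and an action, with the weights
divided by `c`. -/
noncomputable def derivBranches (M : Finset A) (a : A) (c : ℝ) (l : List (ℝ × Proc A)) :
    List (ℝ × Proc A) :=
  ((l.filter fun x => x.2.menu = M).filterMap fun x =>
    (x.2.step a).map fun q => (x.1 / c, q)).flatMap pflat

lemma after_pr (l : List (ℝ × Proc A)) (M : Finset A) (a : A) :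
    after (pr l) M a =
      if (derivBranches M a ((l.filter fun x => x.2.menu = M).map Prod.fst).sum l).isEmpty then none
      else some (pr (derivBranches M a ((l.filter fun x => x.2.menu = M).map Prod.fst).sum l)) := by
  have key (c : ℝ) (sel : List (ℝ × Proc A)) :
      sel.flatMap (fun x => match x.2.step a with
        | none => []
        | some q => flat (x.1 / c) q) =
      (sel.filterMap fun x => (x.2.step a).map fun q => (x.1 / c, q)).flatMap pflat := by
    induction sel with
    | nil => rfl
    | cons x sel ih =>
      rw [List.flatMap_cons, ih, List.filterMap_cons]
      cases x.2.step a with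
      | none => rfl
      | some q => cases q <;> rfl
  unfold derivBranches
  rw [← key]
  rfl

lemma obs_derivBranches (M : Finset A) (a : A) (c : ℝ) {l : List (ℝ × Proc A)}
    (h : ∀ x ∈ l, ∃ k, x.2 = nd k) (t : List (Finset A × A)) (N : Finset A) :
    obs t N (pr (derivBranches M a c l)) = obs ((M, a) :: t) N (pr l) / c := by
  rw [derivBranches, obs_flatMap_pflat, obs_pr]
  induction l with
  | nil => simp
  | cons x l ih =>
    have ih := ih fun y hy => h y (List.mem_cons_of_mem _ hy)
    obtain ⟨k, hk⟩ := h x List.mem_cons_self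
    rw [List.map_cons, List.sum_cons, add_div, ← ih, hk]
    by_cases hM : menu (nd k) = M
    · rw [List.filter_cons_of_pos (by simp [hk, hM]), List.filterMap_cons, hk]
      cases hs : step (nd k) a with
      | none => simp [obs, ndVal, hM, hs]
      | some q => simp [obs, ndVal, hM, hs, mul_div_right_comm]
    · rw [List.filter_cons_of_neg (by simp [hk, hM])]
      simp [obs, ndVal, hM]

lemma sum_filter_menu {l : List (ℝ × Proc A)} (h : ∀ x ∈ l, ∃ k, x.2 = nd k) (M : Finset A) :
    ((l.filter fun x => x.2.menu = M).map Prod.fst).sum = obs [] M (pr l) := by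
  rw [obs_pr]
  induction l with
  | nil => rfl
  | cons x l ih =>
    have ih := ih fun y hy => h y (List.mem_cons_of_mem _ hy)
    obtain ⟨k, hk⟩ := h x List.mem_cons_self
    rw [List.map_cons, List.sum_cons, ← ih, hk]
    by_cases hM : menu (nd k) = M
    · rw [List.filter_cons_of_pos (by simp [hk, hM])]
      simp [obs, ndVal, hM]
    · rw [List.filter_cons_of_neg (by simp [hk, hM])]
      simp [obs, ndVal, hM]

lemma Proper.after_eq_none {s : Proc A} (hs : Proper s) {M : Finset A} {a : A} (ha : a ∉ M) :
    after s M a = none := by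
  have key (k : List (A × Proc A)) (hk : menu (Proc.nd k) = M) :
      Proc.step (Proc.nd k) a = none := by
    rwa [← hk, mem_menu_iff, Option.not_isSome_iff_eq_none] at ha
  cases hs with
  | nd k =>
    rw [after]
    split_ifs with hM
    · exact key k hM
    · rfl
  | pr l h1 h2 h3 =>
    rw [after_pr, if_pos]
    rw [List.isEmpty_iff, derivBranches]
    suffices h : ((l.filter fun x => x.2.menu = M).filterMap fun x => (x.2.step a).map fun q =>
        (x.1 / ((l.filter fun x => x.2.menu = M).map Prod.fst).sum, q)) = [] by
      rw [h]; rfl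
    rw [List.filterMap_eq_nil_iff]
    intro x hx
    obtain ⟨hxl, hx⟩ := List.mem_filter.1 hx
    obtain ⟨k, hk⟩ := h2 x hxl
    rw [hk] at hx ⊢
    rw [key k (of_decide_eq_true hx)]
    rfl

lemma Proper.exists_after_eq_some {s : Proc A} (hs : Proper s) {M : Finset A} {a : A}
    (ha : a ∈ M) (hM : 0 < P1 s M) :
    ∃ s', after s M a = some s' ∧ Proper s' ∧
      ∀ t N, obs t N s' = obs ((M, a) :: t) N s / obs [] M s := by
  rw [hs.P1_eq] at hM
  have key (k : List (A × Proc A)) (hk : menu (Proc.nd k) = M) :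
      ∃ q, Proc.step (Proc.nd k) a = some q := by
    rwa [← hk, mem_menu_iff, Option.isSome_iff_exists] at ha
  cases hs with
  | nd k hk =>
    by_cases h : menu (Proc.nd k) = M
    · obtain ⟨q, hq⟩ := key k h
      refine ⟨q, ?_, Proper.step (.nd k hk) hq, fun t N => ?_⟩
      · rw [after]
        exact (if_pos h).trans hq
      · simp [obs, h, hq]
    · simp [obs, h] at hM
  | pr l h1 h2 h3 =>
    have hsel := sum_filter_menu h2 M
    have hne : (l.filter fun x => x.2.menu = M) ≠ [] := by
      intro h0
      rw [h0] at hsel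
      simp [← hsel] at hM
    have hp : Proper (Proc.pr (derivBranches M a
        ((l.filter fun x => x.2.menu = M).map Prod.fst).sum l)) := by
      refine Proper.pr_flatMap_pflat ?_ fun y hy => ?_
      · obtain ⟨x, hx⟩ := List.exists_mem_of_ne_nil _ hne
        intro h0
        rw [List.filterMap_eq_nil_iff] at h0
        have h0 := h0 x hx
        obtain ⟨hxl, hx⟩ := List.mem_filter.1 hx
        obtain ⟨k, hk⟩ := h2 x hxl
        rw [hk] at hx h0
        obtain ⟨q, hq⟩ := key k (of_decide_eq_true hx)
        simp [hq] at h0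
      · obtain ⟨x, hx, hxy⟩ := List.mem_filterMap.1 hy
        have hxl := List.mem_of_mem_filter hx
        obtain ⟨k, hk⟩ := h2 x hxl
        rw [hk, Option.map_eq_some_iff] at hxy
        obtain ⟨q, hq, rfl⟩ := hxy
        exact Proper.step (hk ▸ h3 x hxl) hq
    refine ⟨_, ?_, hp, fun t N => ?_⟩
    · rw [after_pr, if_neg]
      rw [List.isEmpty_iff]
      exact hp.ne_nil
    · rw [obs_derivBranches M a _ h2, hsel]

lemma rtEquiv_of_obs_eq {s t : Proc A} (hs : Proper s) (ht : Proper t)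
    (h : ∀ tr M, obs tr M s = obs tr M t) : RTEquiv s t := by
  intro tr M
  induction tr generalizing s t with
  | nil => rw [Pn, Pn, hs.P1_eq, ht.P1_eq, h]
  | cons x tr ih =>
    obtain ⟨N, a⟩ := x
    have hP : P1 s N = P1 t N := by rw [hs.P1_eq, ht.P1_eq, h]
    rw [Pn, Pn, hP]
    split_ifs with hN
    · by_cases ha : a ∈ N
      · obtain ⟨s', hs', ps', os'⟩ := hs.exists_after_eq_some ha (hP ▸ hN)
        obtain ⟨t', ht', pt', ot'⟩ := ht.exists_after_eq_some ha hN
        rw [hs', ht']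
        refine ih ps' pt' fun tr M => ?_
        rw [os', ot', h, h]
      · rw [hs.after_eq_none ha, ht.after_eq_none ha]
    · rfl

end Proper

section Contexts

variable {A : Type} [DecidableEq A] [LT A] [DecidableRel ((· < ·) : A → A → Prop)] [Fintype A]

/-- Denotations of the branches of a term. -/
def DenBranches {B : Type} (l : List (B × CSPp A)) (m : List (B × Proc A)) : Prop :=
  List.Forall₂ (fun x y => y.1 = x.1 ∧ Den x.2 y.2) l m

lemma DenBranches.unique {B : Type} {l : List (B × CSPp A)} {m m' : List (B × Proc A)}
    (h : DenBranches l m) (h' : DenBranches l m') : m = m' :=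
  forall₂_unique (fun _ _ _ h h' => Prod.ext (h.1.trans h'.1.symm) (h.2.unique h'.2)) h h'

lemma DenBranches.exists_eq_append_cons {B : Type} {pre suf : List (B × CSPp A)} {b : B}
    {p : CSPp A} {m : List (B × Proc A)} (h : DenBranches (pre ++ (b, p) :: suf) m) :
    ∃ pre' q suf', m = pre' ++ (b, q) :: suf' ∧ DenBranches pre pre' ∧ Den p q ∧
      DenBranches suf suf' := by
  induction pre generalizing m with
  | nil =>
    obtain ⟨⟨c, q⟩, suf', ⟨rfl, hq⟩, hsuf, rfl⟩ := List.forall₂_cons_left_iff.1 h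
    exact ⟨[], q, suf', rfl, .nil, hq, hsuf⟩
  | cons x pre ih =>
    obtain ⟨y, m', hy, hm', rfl⟩ := List.forall₂_cons_left_iff.1 h
    obtain ⟨pre', q, suf', rfl, hpre, hq, hsuf⟩ := ih hm'
    exact ⟨y :: pre', q, suf', rfl, .cons hy hpre, hq, hsuf⟩

lemma Den.of_ext {l : List (A × CSPp A)} {q : Proc A} (h : Den (.ext l) q) :
    ∃ m, q = nd m ∧ DenBranches l m := by
  cases h with
  | ext _ m hl hk hr => exact ⟨m, rfl, forall₂_of_get hl fun i hi hi' => ⟨hk i hi hi', hr i hi hi'⟩⟩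

lemma Den.of_prob {l : List (ℝ × CSPp A)} {q : Proc A} (h : Den (.prob l) q) :
    ∃ m, q = pr (m.flatMap pflat) ∧ DenBranches l m := by
  cases h with
  | prob _ m hl hk hr =>
    exact ⟨m, rfl, forall₂_of_get hl fun i hi hi' => ⟨hk i hi hi', hr i hi hi'⟩⟩

/-- Contexts preserve convex decompositions of observations. -/
lemma obs_fill_eq_sum {ι : Type*} [Fintype ι] {w : ι → ℝ} (hw : ∑ i, w i = 1) {p : CSPp A}
    {x : ι → CSPp A}
    (h : ∀ (q : Proc A) (y : ι → Proc A), Den p q → (∀ i, Den (x i) (y i)) →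
      ∀ t M, obs t M q = ∑ i, w i * obs t M (y i))
    (C : CSPp.Ctx A) {q : Proc A} {y : ι → Proc A} (hq : Den (C.fill p) q)
    (hy : ∀ i, Den (C.fill (x i)) (y i)) (t : List (Finset A × A)) (M : Finset A) :
    obs t M q = ∑ i, w i * obs t M (y i) := by
  induction C generalizing q y t M with
  | hole => exact h q y hq hy t M
  | ext pre b C suf ih =>
    obtain ⟨m, rfl, hm⟩ := hq.of_ext
    obtain ⟨pre', q, suf', rfl, hpre, hq, hsuf⟩ := hm.exists_eq_append_cons
    have hy' (i : ι) : ∃ z, Den (C.fill (x i)) z ∧ y i = nd (pre' ++ (b, z) :: suf') := by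
      obtain ⟨m, e, hm⟩ := (hy i).of_ext
      obtain ⟨pre'', z, suf'', rfl, hpre', hz, hsuf'⟩ := hm.exists_eq_append_cons
      obtain rfl := hpre.unique hpre'
      obtain rfl := hsuf.unique hsuf'
      exact ⟨z, hz, e⟩
    choose z hz e using hy'
    simp only [e]
    exact obs_nd_append_cons_eq_sum hw pre' suf' b (fun t M => ih hq hz t M) t M
  | prob pre b C suf ih =>
    obtain ⟨m, rfl, hm⟩ := hq.of_prob
    obtain ⟨pre', q, suf', rfl, hpre, hq, hsuf⟩ := hm.exists_eq_append_cons
    have hy' (i : ι) : ∃ z, Den (C.fill (x i)) z ∧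
        y i = pr ((pre' ++ (b, z) :: suf').flatMap pflat) := by
      obtain ⟨m, e, hm⟩ := (hy i).of_prob
      obtain ⟨pre'', z, suf'', rfl, hpre', hz, hsuf'⟩ := hm.exists_eq_append_cons
      obtain rfl := hpre.unique hpre'
      obtain rfl := hsuf.unique hsuf'
      exact ⟨z, hz, e⟩
    choose z hz e using hy'
    simp only [e, obs_flatMap_pflat, List.map_append, List.map_cons, List.sum_append,
      List.sum_cons, mul_add, Finset.sum_add_distrib, ← Finset.sum_mul, hw, one_mul, ih hq hz,
      Finset.mul_sum, mul_left_comm]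
  | theta C ih =>
    cases hq with
    | theta _ q q' hq hr =>
      have hy' (i : ι) : ∃ z, Den (C.fill (x i)) z ∧ ThetaRel z (y i) := by
        cases hy i with
        | theta _ z _ hz hr => exact ⟨z, hz, hr⟩
      choose z hz hzy using hy'
      obtain ⟨f, hf, hobs⟩ := exists_obs_thetaRel t M
      simp only [hobs _ _ hr, hobs _ _ (hzy _)]
      exact mem_obsSpan_apply_eq_sum (fun t M => ih hq hz t M) hf
  | parl C s ih =>
    cases hq with
    | par _ _ q s' _ hq hs hr =>
      have hy' (i : ι) : ∃ z, Den (C.fill (x i)) z ∧ ParRel Finset.univ z s' (y i) := by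
        cases hy i with
        | par _ _ z s'' _ hz hs' hr => exact ⟨z, hz, hs.unique hs' ▸ hr⟩
      choose z hz hzy using hy'
      exact obs_eq_sum_of_parRel_left (fun t M => ih hq hz t M) hr hzy t M
  | parr s C ih =>
    cases hq with
    | par _ _ s' q _ hs hq hr =>
      have hy' (i : ι) : ∃ z, Den (C.fill (x i)) z ∧ ParRel Finset.univ s' z (y i) := by
        cases hy i with
        | par _ _ s'' z _ hs' hz hr => exact ⟨z, hz, hs.unique hs' ▸ hr⟩
      choose z hz hzy using hy'
      exact obs_eq_sum_of_parRel_right (fun t M => ih hq hz t M) hr hzy t M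
  | parLl L C s ih =>
    cases hq with
    | parL _ _ _ q s' _ hq hs hr =>
      have hy' (i : ι) : ∃ z, Den (C.fill (x i)) z ∧ ParRel L z s' (y i) := by
        cases hy i with
        | parL _ _ _ z s'' _ hz hs' hr => exact ⟨z, hz, hs.unique hs' ▸ hr⟩
      choose z hz hzy using hy'
      exact obs_eq_sum_of_parRel_left (fun t M => ih hq hz t M) hr hzy t M
  | parLr L s C ih =>
    cases hq with
    | parL _ _ _ s' q _ hs hq hr =>
      have hy' (i : ι) : ∃ z, Den (C.fill (x i)) z ∧ ParRel L s' z (y i) := by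
        cases hy i with
        | parL _ _ _ s'' z _ hs' hz hr => exact ⟨z, hz, hs.unique hs' ▸ hr⟩
      choose z hz hzy using hy'
      exact obs_eq_sum_of_parRel_right (fun t M => ih hq hz t M) hr hzy t M

lemma sum_map_eq_sum_get {α : Type*} (f : α → ℝ) (l : List α) :
    (l.map f).sum = ∑ i, f (l.get i) := by
  conv_lhs => rw [← List.ofFn_get l, List.map_ofFn, List.sum_ofFn]
  rfl

lemma obs_den_prob_map {l : List (ℝ × CSPp A)} (D : CSPp A → CSPp A) {q : Proc A}
    (hq : Den (.prob (l.map fun x => (x.1, D x.2))) q) :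
    ∃ y : Fin l.length → Proc A, (∀ i, Den (D (l.get i).2) (y i)) ∧
      ∀ t M, obs t M q = ∑ i, (l.get i).1 * obs t M (y i) := by
  obtain ⟨m, rfl, hm⟩ := hq.of_prob
  unfold DenBranches at hm
  rw [List.forall₂_map_left_iff, List.forall₂_iff_get] at hm
  obtain ⟨hl, hm⟩ := hm
  refine ⟨fun i => (m.get (i.cast hl)).2, fun i => (hm i i.2 (hl ▸ i.2)).2, fun t M => ?_⟩
  rw [obs_flatMap_pflat, sum_map_eq_sum_get]
  refine (Fintype.sum_equiv (finCongr hl) _ _ fun i => ?_).symm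
  rw [← (hm i i.2 (hl ▸ i.2)).1]
  rfl

end Contexts

end Proc

/-- Every CSP_p context distributes over probabilistic choice up to
probabilistic ready trace equivalence:
`C[⊕_{i∈I} πᵢ xᵢ] ≈_O ⊕_{i∈I} πᵢ C[xᵢ]`. -/
theorem context_distributes_over_prob_choice
    {A : Type} [DecidableEq A] [LT A]
    [DecidableRel ((· < ·) : A → A → Prop)] [Fintype A]
    (C : CSPp.Ctx A) (hC : ∀ q : CSPp A, CSPp.WFt q → CSPp.WFt (C.fill q))
    (l : List (ℝ × CSPp A))
    (hw : ∀ x ∈ l, 0 < x.1 ∧ x.1 ≤ 1)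
    (hsum : (l.map Prod.fst).sum = 1)
    (hx : ∀ x ∈ l, CSPp.WFt x.2) :
    Proc.CSPEquiv (C.fill (CSPp.prob l))
      (CSPp.prob (l.map fun x => (x.1, C.fill x.2))) := by
  intro ps pt hs ht
  have hprob : CSPp.WFt (.prob l) := .prob l hw hsum hx
  have hfill : CSPp.WFt (.prob (l.map fun x => (x.1, C.fill x.2))) := by
    refine .prob _ ?_ ?_ ?_
    · intro y hy
      obtain ⟨x, hxl, rfl⟩ := List.mem_map.1 hy
      exact hw x hxl
    · simpa [List.map_map, Function.comp_def] using hsum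
    · intro y hy
      obtain ⟨x, hxl, rfl⟩ := List.mem_map.1 hy
      exact hC _ (hx x hxl)
  refine Proc.rtEquiv_of_obs_eq (hs.proper (hC _ hprob)) (ht.proper hfill) fun t M => ?_
  obtain ⟨y, hy, hobs⟩ := Proc.obs_den_prob_map C.fill ht
  rw [hobs]
  refine Proc.obs_fill_eq_sum (w := fun i => (l.get i).1) (x := fun i => (l.get i).2) ?_ ?_
    C hs hy t M
  · rw [← hsum, Proc.sum_map_eq_sum_get]
  · intro q z hq hz t M
    obtain ⟨z', hz', hobs⟩ := Proc.obs_den_prob_map id (l := l) (by simpa using hq)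
    rw [hobs]
    simp only [(hz' _).unique (hz _)]
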